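/- Let a, b ∈ ℝ with a + b = 1/2, and for λ ∈ ℂ \ {0} let A(λ) = [[0, aλ⁻¹ + b], [aλ + b, 0]] and M(λ) := exp(2πi·A(λ)). Then the monodromy closing conditions at λ = 1 hold: M(1) = −𝟙 (minus the 2×2 identity matrix), and the map λ ↦ M(λ) is complex-differentiable at λ = 1 with derivative 0, i.e. ∂_λ M|_{λ=1} = 0. -/

import Mathlib

open scoped Real

theorem exp_antidiag (p q w : ℂ) (hw : w ≠ 0) (h : p * q = w ^ 2) :
    NormedSpace.exp !![0, p; q, 0] =
      !![Complex.cosh w, Complex.sinh w / w * p; Complex.sinh w / w * q, Complex.cosh w] := by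
  have hq : q ≠ 0 := by
    rintro rfl
    simp at h
    exact hw (by simpa using h.symm)
  set U : Matrix (Fin 2) (Fin 2) ℂ := !![w, -w; q, q] with hU
  have hdet : IsUnit U.det := by
    rw [isUnit_iff_ne_zero, hU, Matrix.det_fin_two_of]
    have : w * q - -w * q = 2 * (w * q) := by ring
    rw [this]
    exact mul_ne_zero two_ne_zero (mul_ne_zero hw hq)
  have hUU : IsUnit U := (Matrix.isUnit_iff_isUnit_det U).2 hdet
  have h1 : !![0, p; q, 0] = U * Matrix.diagonal ![w, -w] * U⁻¹ := by
    have : !![0, p; q, 0] * U = U * Matrix.diagonal ![w, -w] := by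
      ext i j
      fin_cases i <;> fin_cases j <;> simp [hU, Matrix.mul_apply, Fin.sum_univ_two, h] <;> ring
    rw [← this, Matrix.mul_assoc, Matrix.mul_nonsing_inv _ hdet, Matrix.mul_one]
  have h2 : !![Complex.cosh w, Complex.sinh w / w * p; Complex.sinh w / w * q, Complex.cosh w]
      = U * Matrix.diagonal ![Complex.exp w, Complex.exp (-w)] * U⁻¹ := by
    have : !![Complex.cosh w, Complex.sinh w / w * p; Complex.sinh w / w * q, Complex.cosh w] * U
        = U * Matrix.diagonal ![Complex.exp w, Complex.exp (-w)] := by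
      have e1 : Complex.exp w = Complex.cosh w + Complex.sinh w := (Complex.cosh_add_sinh w).symm
      have e2 : Complex.exp (-w) = Complex.cosh w - Complex.sinh w :=
        (Complex.cosh_sub_sinh w).symm
      have e3 : Complex.sinh w / w * p * q = Complex.sinh w * w := by
        rw [mul_assoc, h]; field_simp
      have e4 : Complex.sinh w / w * q * w = Complex.sinh w * q := by field_simp
      ext i j
      fin_cases i <;> fin_cases j <;>
        simp [hU, Matrix.mul_apply, Fin.sum_univ_two, e3, e4] <;> simp only [e1, e2] <;> ring
    rw [← this, Matrix.mul_assoc, Matrix.mul_nonsing_inv _ hdet, Matrix.mul_one]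
  rw [h1, h2, Matrix.exp_conj _ _ hUU, Matrix.exp_diagonal]
  congr 3
  ext i
  rw [Pi.coe_exp, ← Complex.exp_eq_exp_ℂ]
  fin_cases i <;> simp

/-- For `a, b ∈ ℝ` with `a + b = 1/2`, the monodromy
`M(λ) = exp(2πi·A(λ))` of the Delaunay residue
`A(λ) = [[0, aλ⁻¹ + b], [aλ + b, 0]]` satisfies the closing conditions at
`λ = 1`: `M(1) = −𝟙`, and `λ ↦ M(λ)` is (entrywise) complex-differentiable at
`λ = 1` with derivative `0`. -/
theorem delaunay_closing_conditions (a b : ℝ) (hab : a + b = 1 / 2)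
    (A M : ℂ → Matrix (Fin 2) (Fin 2) ℂ)
    (hA : ∀ lam : ℂ, lam ≠ 0 → A lam = !![0, (a : ℂ) * lam⁻¹ + b; (a : ℂ) * lam + b, 0])
    (hM : ∀ lam : ℂ, M lam = NormedSpace.exp ((2 * (π : ℂ) * Complex.I) • A lam)) :
    M 1 = -1 ∧ ∀ i j : Fin 2, HasDerivAt (fun lam => M lam i j) 0 1 := by
  have habC : (a : ℂ) + b = 1 / 2 := by
    rw [← Complex.ofReal_add, hab]
    norm_num
  let c : ℂ := 2 * (π : ℂ) * Complex.I
  let f : ℂ → ℂ := fun lam => (a : ℂ) * lam⁻¹ + b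
  let g : ℂ → ℂ := fun lam => (a : ℂ) * lam + b
  let s : ℂ → ℂ := fun lam => 4 * (f lam * g lam)
  let w : ℂ → ℂ := fun lam => (π : ℂ) * Complex.I * Complex.exp (Complex.log (s lam) / 2)
  have hf1 : f 1 = 1 / 2 := by simp only [f]; simpa using habC
  have hg1 : g 1 = 1 / 2 := by simp only [g]; simpa using habC
  have hs1 : s 1 = 1 := by simp only [s, hf1, hg1]; norm_num
  have hw1 : w 1 = π * Complex.I := by simp [w, hs1]
  have hπ : (π : ℂ) * Complex.I ≠ 0 :=
    mul_ne_zero (by exact_mod_cast Real.pi_ne_zero) Complex.I_ne_zero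
  have hw0 : ∀ lam, w lam ≠ 0 := fun lam => mul_ne_zero hπ (Complex.exp_ne_zero _)
  have hf : HasDerivAt f (-a) 1 := by
    have := ((hasDerivAt_inv (one_ne_zero (α := ℂ))).const_mul (a : ℂ)).add_const (b : ℂ)
    exact this.congr_deriv (by simp)
  have hg : HasDerivAt g a 1 := by
    have := ((hasDerivAt_id (1 : ℂ)).const_mul (a : ℂ)).add_const (b : ℂ)
    exact this.congr_deriv (by simp)
  have hs : HasDerivAt s 0 1 := by
    have := (hf.mul hg).const_mul (4 : ℂ)
    rw [hf1, hg1] at this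
    refine HasDerivAt.congr_deriv this ?_
    ring
  have hw : HasDerivAt w 0 1 := by
    have h1 := hs.clog (by rw [hs1]; exact Complex.one_mem_slitPlane)
    have := ((h1.div_const 2).cexp).const_mul ((π : ℂ) * Complex.I)
    refine HasDerivAt.congr_deriv this ?_
    simp
  have hch1 : Complex.cosh (w 1) = -1 := by rw [hw1, Complex.cosh_mul_I]; simp
  have hsh1 : Complex.sinh (w 1) = 0 := by rw [hw1, Complex.sinh_mul_I]; simp
  have hch : HasDerivAt (fun l => Complex.cosh (w l)) 0 1 := by
    simpa using hw.ccosh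
  have hq : HasDerivAt (fun l => Complex.sinh (w l) / w l) 0 1 := by
    have := hw.csinh.div hw (hw0 1)
    refine HasDerivAt.congr_deriv this ?_
    simp
  have key : ∀ lam : ℂ, lam ≠ 0 → s lam ≠ 0 → M lam =
      !![Complex.cosh (w lam), Complex.sinh (w lam) / w lam * (c * f lam);
        Complex.sinh (w lam) / w lam * (c * g lam), Complex.cosh (w lam)] := by
    intro lam hl hsl
    rw [← exp_antidiag _ _ _ (hw0 lam), hM, hA lam hl]
    · congr 1
      ext i j
      fin_cases i <;> fin_cases j <;> simp [c, f, g]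
    · have : Complex.exp (Complex.log (s lam) / 2) ^ 2 = s lam := by
        rw [← Complex.exp_nat_mul]
        push_cast
        rw [mul_div_cancel₀ _ two_ne_zero, Complex.exp_log hsl]
      simp only [w]
      rw [mul_pow, this]
      simp only [c, s]
      ring
  have hev : ∀ᶠ lam in nhds (1 : ℂ), M lam =
      !![Complex.cosh (w lam), Complex.sinh (w lam) / w lam * (c * f lam);
        Complex.sinh (w lam) / w lam * (c * g lam), Complex.cosh (w lam)] := by
    filter_upwards [eventually_ne_nhds (one_ne_zero (α := ℂ)),
      hs.continuousAt.eventually_ne (by rw [hs1]; exact one_ne_zero)] with lam h1 h2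
    exact key lam h1 h2
  refine ⟨?_, ?_⟩
  · rw [hev.self_of_nhds, hch1, hsh1]
    ext i j
    fin_cases i <;> fin_cases j <;> simp
  · have hF : HasDerivAt (fun l => Complex.sinh (w l) / w l * (c * f l)) 0 1 := by
      have := hq.mul (hf.const_mul c)
      refine HasDerivAt.congr_deriv this ?_
      simp [hsh1]
    have hG : HasDerivAt (fun l => Complex.sinh (w l) / w l * (c * g l)) 0 1 := by
      have := hq.mul (hg.const_mul c)
      refine HasDerivAt.congr_deriv this ?_
      simp [hsh1]
    intro i j
    have e : (fun lam => M lam i j) =ᶠ[nhds 1] fun lam =>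
      !![Complex.cosh (w lam), Complex.sinh (w lam) / w lam * (c * f lam);
        Complex.sinh (w lam) / w lam * (c * g lam), Complex.cosh (w lam)] i j :=
      hev.mono fun l hl => by simp only [hl]
    refine HasDerivAt.congr_of_eventuallyEq ?_ e
    fin_cases i <;> fin_cases j
    · exact hch
    · exact hF
    · exact hG
    · exact hch
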